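/- Consistent tangent operator for the von Mises model: the set U = {ε ∈ Sym(3) : |s^tr(ε)| > Y} is open, and on U the operator T_k is Fréchet differentiable with derivative given, for every direction h ∈ Sym(3), by DT_k(ε)[h] = ℂh − (4G²/(2G + a))·dev(h) + (4G²/(2G + a))·(Y/|s^tr(ε)|)·(dev(h) − (n^tr(ε) : h)·n^tr(ε)). -/

import Mathlib

open Matrix

/-- Frobenius inner product on 3×3 real matrices. -/
noncomputable def frob (σ τ : Matrix (Fin 3) (Fin 3) ℝ) : ℝ := ∑ i, ∑ j, σ i j * τ i j

/-- Frobenius norm. -/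
noncomputable def fnorm (τ : Matrix (Fin 3) (Fin 3) ℝ) : ℝ := Real.sqrt (frob τ τ)

/-- Deviatoric part. -/
noncomputable def devM (τ : Matrix (Fin 3) (Fin 3) ℝ) : Matrix (Fin 3) (Fin 3) ℝ :=
  τ - (Matrix.trace τ / 3) • (1 : Matrix (Fin 3) (Fin 3) ℝ)

/-- The isotropic elasticity tensor `ℂε = K tr(ε) I + 2G dev(ε)`. -/
noncomputable def Celast (K G : ℝ) (ε : Matrix (Fin 3) (Fin 3) ℝ) : Matrix (Fin 3) (Fin 3) ℝ :=
  (K * Matrix.trace ε) • (1 : Matrix (Fin 3) (Fin 3) ℝ) + (2 * G) • devM ε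

attribute [local instance] Matrix.frobeniusNormedAddCommGroup Matrix.frobeniusNormedSpace

/-- Trial deviatoric stress `s^tr(ε) = dev(ℂ(ε − εₖ₋₁ᵖ)) − βₖ₋₁`. -/
noncomputable def strVM (K G : ℝ) (εp βp ε : Matrix (Fin 3) (Fin 3) ℝ) :
    Matrix (Fin 3) (Fin 3) ℝ :=
  devM (Celast K G (ε - εp)) - βp

/-- Normalized trial flow direction `n^tr(ε) = s^tr(ε)/|s^tr(ε)|`. -/
noncomputable def ntrVM (K G : ℝ) (εp βp ε : Matrix (Fin 3) (Fin 3) ℝ) :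
    Matrix (Fin 3) (Fin 3) ℝ :=
  (fnorm (strVM K G εp βp ε))⁻¹ • strVM K G εp βp ε

/-- The von Mises stress-strain operator `T_k`. -/
noncomputable def TVM (K G a Y : ℝ) (εp βp ε : Matrix (Fin 3) (Fin 3) ℝ) :
    Matrix (Fin 3) (Fin 3) ℝ :=
  if fnorm (strVM K G εp βp ε) ≤ Y then Celast K G (ε - εp)
  else Celast K G (ε - εp) -
    (2 * G / (2 * G + a) * (fnorm (strVM K G εp βp ε) - Y)) • ntrVM K G εp βp ε

theorem trace_devM (τ : Matrix (Fin 3) (Fin 3) ℝ) : Matrix.trace (devM τ) = 0 := by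
  simp [devM]

/-- The deviatoric projection as a linear map. -/
noncomputable def devLinear : Matrix (Fin 3) (Fin 3) ℝ →ₗ[ℝ] Matrix (Fin 3) (Fin 3) ℝ where
  toFun := devM
  map_add' σ τ := by simp only [devM, Matrix.trace_add]; module
  map_smul' c τ := by
    simp only [devM, Matrix.trace_smul, smul_eq_mul, RingHom.id_apply]; module

/-- The elasticity tensor as a linear map. -/
noncomputable def celastLinear (K G : ℝ) :
    Matrix (Fin 3) (Fin 3) ℝ →ₗ[ℝ] Matrix (Fin 3) (Fin 3) ℝ where
  toFun := Celast K G
  map_add' σ τ := by simp only [Celast, devM, Matrix.trace_add]; module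
  map_smul' c τ := by
    simp only [Celast, devM, Matrix.trace_smul, smul_eq_mul, RingHom.id_apply]; module

/-- The Frobenius inner product as a bilinear map. -/
noncomputable def frobBilin :
    Matrix (Fin 3) (Fin 3) ℝ →ₗ[ℝ] Matrix (Fin 3) (Fin 3) ℝ →ₗ[ℝ] ℝ :=
  LinearMap.mk₂ ℝ frob
    (by intros; simp [frob, add_mul, Finset.sum_add_distrib])
    (by intros; simp [frob, mul_assoc, Finset.mul_sum])
    (by intros; simp [frob, mul_add, Finset.sum_add_distrib])
    (by intros; simp [frob, mul_left_comm, Finset.mul_sum])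

theorem frob_comm (σ τ : Matrix (Fin 3) (Fin 3) ℝ) : frob σ τ = frob τ σ := by
  simp [frob, mul_comm]

theorem frob_smul_left (c : ℝ) (σ τ : Matrix (Fin 3) (Fin 3) ℝ) :
    frob (c • σ) τ = c * frob σ τ := by
  simp [frob, mul_assoc, Finset.mul_sum]

theorem frob_smul_right (c : ℝ) (σ τ : Matrix (Fin 3) (Fin 3) ℝ) :
    frob σ (c • τ) = c * frob σ τ := by
  rw [frob_comm, frob_smul_left, frob_comm]

theorem frob_devM_right {σ : Matrix (Fin 3) (Fin 3) ℝ} (hσ : Matrix.trace σ = 0)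
    (τ : Matrix (Fin 3) (Fin 3) ℝ) : frob σ (devM τ) = frob σ τ := by
  simp only [Matrix.trace, Matrix.diag, Fin.sum_univ_three] at hσ
  simp [frob, devM, Matrix.trace, Fin.sum_univ_three, Matrix.one_apply]
  linear_combination (-(τ 0 0 + τ 1 1 + τ 2 2) / 3) * hσ

theorem devM_Celast (K G : ℝ) (τ : Matrix (Fin 3) (Fin 3) ℝ) :
    devM (Celast K G τ) = (2 * G) • devM τ := by
  have h : Matrix.trace (Celast K G τ) = 3 * (K * Matrix.trace τ) := by
    simp [Celast, trace_devM, mul_comm]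
  rw [devM, h, Celast]
  module

theorem trace_strVM (K G : ℝ) (εp ε : Matrix (Fin 3) (Fin 3) ℝ)
    {βp : Matrix (Fin 3) (Fin 3) ℝ} (hβtr : Matrix.trace βp = 0) :
    Matrix.trace (strVM K G εp βp ε) = 0 := by
  rw [strVM, Matrix.trace_sub, trace_devM, hβtr, sub_zero]

theorem hasFDerivAt_Celast (K G : ℝ) (εp ε : Matrix (Fin 3) (Fin 3) ℝ) :
    HasFDerivAt (fun ε => Celast K G (ε - εp))
      (LinearMap.toContinuousLinearMap (celastLinear K G)) ε :=
  (LinearMap.toContinuousLinearMap (celastLinear K G)).hasFDerivAt.comp ε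
    ((hasFDerivAt_id ε).sub_const εp)

theorem hasFDerivAt_strVM (K G : ℝ) (εp βp ε : Matrix (Fin 3) (Fin 3) ℝ) :
    HasFDerivAt (strVM K G εp βp) ((2 * G) • LinearMap.toContinuousLinearMap devLinear) ε := by
  have h : strVM K G εp βp =
      fun ε => ((2 * G) • LinearMap.toContinuousLinearMap devLinear) (ε - εp) - βp := by
    funext ε
    exact congrArg (· - βp) (devM_Celast K G (ε - εp))
  rw [h]
  exact (((2 * G) • LinearMap.toContinuousLinearMap devLinear).hasFDerivAt.comp ε
    ((hasFDerivAt_id ε).sub_const εp)).sub_const βp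

theorem hasFDerivAt_fnorm {τ : Matrix (Fin 3) (Fin 3) ℝ} (hτ : 0 < fnorm τ) :
    HasFDerivAt fnorm
      ((fnorm τ)⁻¹ • LinearMap.toContinuousLinearMap (frobBilin τ)) τ := by
  have hpos : 0 < frob τ τ := Real.sqrt_pos.mp hτ
  have hq : HasFDerivAt (fun σ => frob σ σ) _ τ :=
    frobBilin.toContinuousBilinearMap.hasFDerivAt_of_bilinear
      (hasFDerivAt_id τ) (hasFDerivAt_id τ)
  refine (hq.sqrt hpos.ne').congr_fderiv ?_
  ext h
  change 1 / (2 * fnorm τ) * (frob τ h + frob h τ) = (fnorm τ)⁻¹ * frob τ h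
  rw [frob_comm h τ]
  field_simp
  ring

theorem continuous_fnorm : Continuous fnorm := by
  have h : Continuous fun τ => frobBilin.toContinuousBilinearMap τ τ := by fun_prop
  exact Real.continuous_sqrt.comp h

theorem isOpen_plastic_region (K G Y : ℝ) (εp βp : Matrix (Fin 3) (Fin 3) ℝ) :
    IsOpen {ε : Matrix (Fin 3) (Fin 3) ℝ | Y < fnorm (strVM K G εp βp ε)} :=
  isOpen_lt continuous_const <| continuous_fnorm.comp <|
    continuous_iff_continuousAt.mpr fun ε => (hasFDerivAt_strVM K G εp βp ε).continuousAt

/-- Consistent tangent operator for the von Mises model: the plastic region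
`U = {ε : |s^tr(ε)| > Y}` is open and on it `T_k` is Fréchet differentiable with
`DT_k(ε)[h] = ℂh − (4G²/(2G+a)) dev h + (4G²/(2G+a)) (Y/|s^tr(ε)|)(dev h − (n^tr : h) n^tr)`. -/
theorem vonMises_consistent_tangent (K G a Y : ℝ) (hK : 0 < K) (hG : 0 < G) (ha : 0 < a)
    (hY : 0 < Y) (εp βp : Matrix (Fin 3) (Fin 3) ℝ) (hεp : εp.IsSymm) (hβp : βp.IsSymm)
    (hβtr : Matrix.trace βp = 0) :
    IsOpen {ε : Matrix (Fin 3) (Fin 3) ℝ | Y < fnorm (strVM K G εp βp ε)} ∧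
    ∀ ε : Matrix (Fin 3) (Fin 3) ℝ, Y < fnorm (strVM K G εp βp ε) →
      ∃ D : Matrix (Fin 3) (Fin 3) ℝ →L[ℝ] Matrix (Fin 3) (Fin 3) ℝ,
        HasFDerivAt (TVM K G a Y εp βp) D ε ∧
        ∀ h : Matrix (Fin 3) (Fin 3) ℝ,
          D h = Celast K G h - (4 * G ^ 2 / (2 * G + a)) • devM h +
            (4 * G ^ 2 / (2 * G + a) * (Y / fnorm (strVM K G εp βp ε))) •
              (devM h - frob (ntrVM K G εp βp ε) h • ntrVM K G εp βp ε) := by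
  refine ⟨isOpen_plastic_region K G Y εp βp, fun ε hε => ?_⟩
  have hpos : 0 < fnorm (strVM K G εp βp ε) := hY.trans hε
  have hs := hasFDerivAt_strVM K G εp βp ε
  have hn := (hasFDerivAt_fnorm hpos).comp ε hs
  have hT := (hasFDerivAt_Celast K G εp ε).sub
    (((hn.sub_const Y).const_mul (2 * G / (2 * G + a))).smul
      (((hasDerivAt_inv hpos.ne').comp_hasFDerivAt ε hn).smul hs))
  refine ⟨_, hT.congr_of_eventuallyEq ?_, fun h => ?_⟩
  · filter_upwards [(isOpen_plastic_region K G Y εp βp).mem_nhds hε] with x hx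
    exact if_neg (not_le.mpr hx)
  · have hfrob : frob (strVM K G εp βp ε) ((2 * G) • devM h) =
        2 * G * frob (strVM K G εp βp ε) h := by
      rw [frob_smul_right, frob_devM_right (trace_strVM K G εp ε hβtr)]
    rw [ntrVM, frob_smul_left]
    set s := strVM K G εp βp ε
    set N := fnorm s
    change Celast K G h -
      ((2 * G / (2 * G + a) * (N - Y)) •
          (N⁻¹ • ((2 * G) • devM h) +
            (-(N ^ 2)⁻¹ * (N⁻¹ * frob s ((2 * G) • devM h))) • s) +
        (2 * G / (2 * G + a) * (N⁻¹ * frob s ((2 * G) • devM h))) • (N⁻¹ • s)) = _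
    rw [hfrob]
    match_scalars <;> field_simp <;> ring
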